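/- Let D, n be positive integers, λ > 0, G ≥ 2, β ≥ 1 real numbers, and let θ*, x̃, x_1, …, x_n ∈ ℝ^D. Define V_0 = λ I_D and V_τ = V_{τ−1} + x_τ x_τᵀ. Suppose that for each τ ∈ {1,…,n}: (a) ⟨x̃ − x_τ, θ*⟩ ≤ G, and (b) there exists θ̃_τ ∈ ℝ^D with ‖θ̃_τ − θ*‖_{V_{τ−1}} ≤ 2β and ⟨x̃, θ*⟩ ≤ ⟨x_τ, θ̃_τ⟩. Then Σ_{τ=1}^n ⟨x̃ − x_τ, θ*⟩ ≤ √2 · G · β · √( n · log( det(V_n) / λ^D ) ). -/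

import Mathlib

open Finset Matrix

/-- The norm `‖x‖_M = √(xᵀ M x)` associated with a (positive definite) matrix `M`. -/
noncomputable def matNorm {D : ℕ} (M : Matrix (Fin D) (Fin D) ℝ) (x : Fin D → ℝ) : ℝ :=
  Real.sqrt (x ⬝ᵥ M.mulVec x)

namespace Matrix.PosDef

variable {m : Type*} [Fintype m] [DecidableEq m]

/-- Cauchy-Schwarz for a positive definite matrix and its inverse. -/
theorem sq_dotProduct_le {M : Matrix m m ℝ} (hM : M.PosDef) (x y : m → ℝ) :
    (x ⬝ᵥ y) ^ 2 ≤ (x ⬝ᵥ M⁻¹ *ᵥ x) * (y ⬝ᵥ M *ᵥ y) := by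
  have hunit : IsUnit M.det := hM.det_pos.ne'.isUnit
  have hT : Mᵀ = M := by simpa using hM.isHermitian.eq
  have hMx : M *ᵥ (M⁻¹ *ᵥ x) = x := by
    rw [mulVec_mulVec, mul_nonsing_inv _ hunit, one_mulVec]
  have hsymm : (M⁻¹ *ᵥ x) ⬝ᵥ M *ᵥ y = x ⬝ᵥ y := by
    rw [dotProduct_mulVec, ← mulVec_transpose, hT, hMx]
  have h := LinearMap.BilinForm.apply_mul_apply_le_of_forall_zero_le (Matrix.toBilin' M)
    (fun z => by
      simpa [Matrix.toBilin'_apply'] using hM.posSemidef.dotProduct_mulVec_nonneg z)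
    (M⁻¹ *ᵥ x) y
  simp only [Matrix.toBilin'_apply', hMx, hsymm] at h
  rw [dotProduct_comm y x, dotProduct_comm _ x] at h
  rwa [sq]

theorem det_add_vecMulVec_self {M : Matrix m m ℝ} (hM : M.PosDef) (x : m → ℝ) :
    (M + vecMulVec x x).det = M.det * (1 + x ⬝ᵥ M⁻¹ *ᵥ x) := by
  rw [vecMulVec_eq Unit, det_add_replicateCol_mul_replicateRow hM.det_pos.ne'.isUnit,
    det_unique (n := Unit), add_apply, one_apply_eq, Matrix.mul_assoc, ← replicateCol_mulVec,
    replicateRow_mul_replicateCol_apply]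

/-- The elliptical potential identity. -/
theorem log_det_add_sum_vecMulVec {V : ℕ → Matrix m m ℝ} {x : ℕ → m → ℝ}
    (hV : ∀ k, (V k).PosDef) (hsucc : ∀ k, V (k + 1) = V k + vecMulVec (x (k + 1)) (x (k + 1)))
    (n : ℕ) :
    Real.log (V n).det = Real.log (V 0).det +
      ∑ k ∈ Finset.Icc 1 n, Real.log (1 + x k ⬝ᵥ (V (k - 1))⁻¹ *ᵥ x k) := by
  induction n with
  | zero => simp
  | succ k ih =>
    have hpos := (hV k).inv.posSemidef.dotProduct_mulVec_nonneg (x (k + 1))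
    rw [star_trivial] at hpos
    rw [Finset.sum_Icc_succ_top (by omega), hsucc, (hV k).det_add_vecMulVec_self,
      Real.log_mul (hV k).det_pos.ne' (by positivity), ih, Nat.add_sub_cancel, add_assoc]

end Matrix.PosDef

theorem Real.min_one_le_two_mul_log_one_add {u : ℝ} (hu : 0 ≤ u) :
    min 1 u ≤ 2 * Real.log (1 + u) := by
  have h := Real.le_log_one_add_of_nonneg hu
  suffices min 1 u ≤ 2 * (2 * u / (u + 2)) by linarith
  rw [← mul_div_assoc, le_div_iff₀ (by positivity)]
  rcases le_total 1 u with h1 | h1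
  · rw [min_eq_left h1]; linarith
  · rw [min_eq_right h1]; nlinarith

theorem Finset.sum_sqrt_le_sqrt_card_mul_sum {ι : Type*} (s : Finset ι) {f : ι → ℝ}
    (hf : ∀ i ∈ s, 0 ≤ f i) :
    ∑ i ∈ s, √(f i) ≤ √(s.card * ∑ i ∈ s, f i) := by
  apply Real.le_sqrt_of_sq_le
  refine sq_sum_le_card_mul_sum_sq.trans_eq ?_
  congr 1
  exact Finset.sum_congr rfl fun i hi => Real.sq_sqrt (hf i hi)

/-- The regret of an optimistic choice is controlled by the potential increment. -/
theorem regret_le_of_optimism {D : ℕ} {M : Matrix (Fin D) (Fin D) ℝ} (hM : M.PosDef)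
    {G β : ℝ} (hG : 2 ≤ G) (hβ : 1 ≤ β) {θstar θtil xtil x : Fin D → ℝ}
    (hbound : (xtil - x) ⬝ᵥ θstar ≤ G) (hconf : matNorm M (θtil - θstar) ≤ 2 * β)
    (hopt : xtil ⬝ᵥ θstar ≤ x ⬝ᵥ θtil) :
    (xtil - x) ⬝ᵥ θstar ≤ √2 * G * β * √(Real.log (1 + x ⬝ᵥ M⁻¹ *ᵥ x)) := by
  set u := x ⬝ᵥ M⁻¹ *ᵥ x
  have hu : 0 ≤ u := by simpa using hM.inv.posSemidef.dotProduct_mulVec_nonneg x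
  have hle : (xtil - x) ⬝ᵥ θstar ≤ x ⬝ᵥ (θtil - θstar) := by
    rw [sub_dotProduct, dotProduct_sub]; linarith
  have hcs : x ⬝ᵥ (θtil - θstar) ≤ √u * (2 * β) := by
    refine (Real.le_sqrt_of_sq_le (hM.sq_dotProduct_le x (θtil - θstar))).trans ?_
    rw [Real.sqrt_mul hu]
    exact mul_le_mul_of_nonneg_left hconf (Real.sqrt_nonneg _)
  have hmin : (xtil - x) ⬝ᵥ θstar ≤ G * β * √(min 1 u) := by
    rcases le_total 1 u with h1 | h1
    · rw [min_eq_left h1, Real.sqrt_one]; nlinarith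
    · rw [min_eq_right h1]
      refine (hle.trans hcs).trans ?_
      rw [mul_comm]
      gcongr
  calc (xtil - x) ⬝ᵥ θstar ≤ G * β * √(min 1 u) := hmin
    _ ≤ G * β * √(2 * Real.log (1 + u)) := by
      gcongr
      exact Real.min_one_le_two_mul_log_one_add hu
    _ = √2 * G * β * √(Real.log (1 + u)) := by
      rw [Real.sqrt_mul zero_le_two]; ring

/-- deterministic core of the block-OFUL regret bound: under the
bounded instantaneous regret, confidence-ellipsoid and optimism conditions, the regret
is bounded by `√2 · G · β · √(n · log(det V_n / λ^D))`. -/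
theorem stmt_8 (D n : ℕ) (hD : 0 < D) (hn : 0 < n)
    (lam G β : ℝ) (hlam : 0 < lam) (hG : 2 ≤ G) (hβ : 1 ≤ β)
    (θstar xtil : Fin D → ℝ) (x : ℕ → (Fin D → ℝ))
    (V : ℕ → Matrix (Fin D) (Fin D) ℝ)
    (hV : ∀ k : ℕ, V k = lam • (1 : Matrix (Fin D) (Fin D) ℝ) +
      ∑ τ' ∈ Finset.Icc 1 k, vecMulVec (x τ') (x τ'))
    (hbound : ∀ τ ∈ Finset.Icc 1 n, (xtil - x τ) ⬝ᵥ θstar ≤ G)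
    (hopt : ∀ τ ∈ Finset.Icc 1 n, ∃ θtil : Fin D → ℝ,
      matNorm (V (τ - 1)) (θtil - θstar) ≤ 2 * β ∧ xtil ⬝ᵥ θstar ≤ x τ ⬝ᵥ θtil) :
    (∑ τ ∈ Finset.Icc 1 n, (xtil - x τ) ⬝ᵥ θstar) ≤
      Real.sqrt 2 * G * β * Real.sqrt ((n : ℝ) * Real.log ((V n).det / lam ^ D)) := by
  have hpd (k : ℕ) : (V k).PosDef := by
    rw [hV]
    refine (Matrix.PosDef.one.smul hlam).add_posSemidef
      (Matrix.posSemidef_sum _ fun i _ => ?_)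
    simpa using Matrix.posSemidef_vecMulVec_self_star (x i)
  have hsucc (k : ℕ) : V (k + 1) = V k + vecMulVec (x (k + 1)) (x (k + 1)) := by
    rw [hV, hV, Finset.sum_Icc_succ_top (by omega), add_assoc]
  have hdet : (V 0).det = lam ^ D := by simp [hV]
  have hlog : Real.log ((V n).det / lam ^ D) =
      ∑ τ ∈ Finset.Icc 1 n, Real.log (1 + x τ ⬝ᵥ (V (τ - 1))⁻¹ *ᵥ x τ) := by
    rw [Real.log_div (hpd n).det_pos.ne' (by positivity),
      Matrix.PosDef.log_det_add_sum_vecMulVec hpd hsucc, hdet, add_sub_cancel_left]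
  have hnonneg (τ : ℕ) : 0 ≤ Real.log (1 + x τ ⬝ᵥ (V (τ - 1))⁻¹ *ᵥ x τ) := by
    have h := (hpd (τ - 1)).inv.posSemidef.dotProduct_mulVec_nonneg (x τ)
    rw [star_trivial] at h
    exact Real.log_nonneg (by linarith)
  calc (∑ τ ∈ Finset.Icc 1 n, (xtil - x τ) ⬝ᵥ θstar)
      ≤ ∑ τ ∈ Finset.Icc 1 n,
          √2 * G * β * √(Real.log (1 + x τ ⬝ᵥ (V (τ - 1))⁻¹ *ᵥ x τ)) := by
        refine Finset.sum_le_sum fun τ hτ => ?_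
        obtain ⟨θtil, hconf, hle⟩ := hopt τ hτ
        exact regret_le_of_optimism (hpd _) hG hβ (hbound τ hτ) hconf hle
    _ ≤ _ := by
        rw [← Finset.mul_sum, hlog]
        have h := Finset.sum_sqrt_le_sqrt_card_mul_sum (Finset.Icc 1 n) fun τ _ => hnonneg τ
        rw [Nat.card_Icc, Nat.add_sub_cancel] at h
        exact mul_le_mul_of_nonneg_left h (by positivity)
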